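/- Completeness of the complex invariants at a fixed homogeneous degree: suppose φ is a degree-n homogeneous element of the free algebra on x₁, x₂ over ℂ, written as φ = Σ_{(i₁,…,iₙ)} a_{i₁…iₙ} c_{i₁…iₙ} in the basis c_{i₁…iₙ} = z_{i₁}⋯z_{iₙ} (z₁ = x₁+ix₂, z₂ = x₁−ix₂), and suppose ⟨S(X), φ⟩ = ⟨S(R(θ)X), φ⟩ for all piecewise linear curves X and all θ ∈ ℝ. Then a_{i₁…iₙ} = 0 whenever #{k : i_k = 1} ≠ #{k : i_k = 2}. -/

import Mathlib

open Set

/-- Iterated integral over the simplex a ≤ r₁ ≤ ⋯ ≤ rₙ ≤ b of the product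
g₁(r₁)⋯gₙ(rₙ); the head of the list is the innermost (first) variable. -/
noncomputable def itIntC : List (ℝ → ℂ) → ℝ → ℝ → ℂ
  | [], _, _ => 1
  | g :: gs, a, b => ∫ r in a..b, g r * itIntC gs r b

/-- Complexified coordinate curves Z¹ = X¹ + iX², Z² = X¹ − iX²
(letter 0 stands for "1", letter 1 stands for "2"). -/
noncomputable def Zc (X : Fin 2 → ℝ → ℝ) : Fin 2 → ℝ → ℂ :=
  ![fun t => (X 0 t : ℂ) + Complex.I * (X 1 t : ℂ),
    fun t => (X 0 t : ℂ) - Complex.I * (X 1 t : ℂ)]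

/-- ⟨S(X), c_{i₁…iₙ}⟩: the complex iterated integral of the complexified curve over
the word w (so that a homogeneous φ = Σ a_w c_w pairs to Σ a_w · this). -/
noncomputable def sigC (X : Fin 2 → ℝ → ℝ) (T : ℝ) {n : ℕ} (w : Fin n → Fin 2) : ℂ :=
  itIntC ((List.ofFn w).map fun i => deriv (Zc X i)) 0 T

/-- X : [0,T] → ℝ² is continuous piecewise linear. -/
def IsPWLinear (X : Fin 2 → ℝ → ℝ) (T : ℝ) : Prop :=
  ∃ (m : ℕ) (τ : Fin (m + 1) → ℝ), Monotone τ ∧ τ 0 = 0 ∧ τ (Fin.last m) = T ∧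
    ∀ j : Fin m, ∃ V : Fin 2 → ℝ,
      ∀ s ∈ Icc (τ j.castSucc) (τ j.succ), ∀ a : Fin 2,
        X a s = X a (τ j.castSucc) + (s - τ j.castSucc) * V a

/-- The curve rotated by angle θ (rotation matrix with rows (cos θ, sin θ), (−sin θ, cos θ)). -/
noncomputable def rot (θ : ℝ) (X : Fin 2 → ℝ → ℝ) : Fin 2 → ℝ → ℝ :=
  ![fun t => Real.cos θ * X 0 t + Real.sin θ * X 1 t,
    fun t => -Real.sin θ * X 0 t + Real.cos θ * X 1 t]

/-- X is piecewise linear on [c,b], built from the right by adding segments on the left. -/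
inductive PLf (X : Fin 2 → ℝ → ℝ) (b : ℝ) : ℝ → Prop
  | nil : PLf X b b
  | cons (c c' : ℝ) (v : Fin 2 → ℝ) (hc : c' ≤ c)
      (hX : ∀ s ∈ Icc c' c, ∀ i, X i s = X i c' + (s - c') * v i) (h : PLf X b c) : PLf X b c'

theorem PLf.le {X : Fin 2 → ℝ → ℝ} {b c : ℝ} (h : PLf X b c) : c ≤ b := by
  induction h with
  | nil => exact le_rfl
  | cons c c' v hc hX h ih => exact hc.trans ih

theorem PLf.congr {X Y : Fin 2 → ℝ → ℝ} {b c : ℝ} (h : PLf X b c)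
    (hXY : ∀ s, c ≤ s → ∀ i, Y i s = X i s) : PLf Y b c := by
  induction h with
  | nil => exact PLf.nil
  | cons c c' v hc hX h ih =>
    refine PLf.cons c c' v hc ?_ (ih fun s hs i => hXY s (hc.trans hs) i)
    intro s hs i
    rw [hXY s hs.1 i, hXY c' le_rfl i, hX s hs i]

theorem PLf.exists {X : Fin 2 → ℝ → ℝ} {b c : ℝ} (h : PLf X b c) :
    ∃ (m : ℕ) (τ : Fin (m + 1) → ℝ), Monotone τ ∧ τ 0 = c ∧ τ (Fin.last m) = b ∧
    ∀ j : Fin m, ∃ V : Fin 2 → ℝ,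
      ∀ s ∈ Icc (τ j.castSucc) (τ j.succ), ∀ a : Fin 2,
        X a s = X a (τ j.castSucc) + (s - τ j.castSucc) * V a := by
  induction h with
  | nil => exact ⟨0, fun _ => b, monotone_const, rfl, rfl, fun j => j.elim0⟩
  | cons c c' v hc hX h ih =>
    obtain ⟨m, τ, hm, h0, hl, hs⟩ := ih
    refine ⟨m + 1, Fin.cons c' τ, ?_, rfl, ?_, ?_⟩
    · rw [Fin.monotone_iff_le_succ]
      intro i
      refine Fin.cases ?_ (fun j => ?_) i
      · simpa [h0] using hc
      · rw [← Fin.succ_castSucc, Fin.cons_succ, Fin.cons_succ]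
        exact hm (Fin.castSucc_le_succ j)
    · rw [← Fin.succ_last, Fin.cons_succ, hl]
    · intro i
      refine Fin.cases ?_ (fun j => ?_) i
      · refine ⟨v, ?_⟩
        simpa [h0] using hX
      · rw [← Fin.succ_castSucc, Fin.cons_succ, Fin.cons_succ]
        exact hs j

theorem PLf.isPW {X : Fin 2 → ℝ → ℝ} {b c : ℝ} (h : PLf X b c) :
    IsPWLinear (fun i t => X i (t + c)) (b - c) := by
  obtain ⟨m, τ, hm, h0, hl, hs⟩ := h.exists
  refine ⟨m, fun i => τ i - c, fun i j hij => sub_le_sub_right (hm hij) c, by simp [h0],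
    by simp [hl], fun j => ?_⟩
  obtain ⟨V, hV⟩ := hs j
  refine ⟨V, fun s hs a => ?_⟩
  have := hV (s + c) ⟨by linarith [hs.1], by linarith [hs.2]⟩ a
  simp only [sub_add_cancel]
  rw [this]; ring

/-- Iterated integral on [c,b] over a word. -/
noncomputable def Jw (X : Fin 2 → ℝ → ℝ) (l : List (Fin 2)) (c b : ℝ) : ℂ :=
  itIntC (l.map fun i => deriv (Zc X i)) c b

theorem Jw_nil (X : Fin 2 → ℝ → ℝ) (c b : ℝ) : Jw X [] c b = 1 := by simp [Jw, itIntC]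

theorem Jw_cons (X : Fin 2 → ℝ → ℝ) (i : Fin 2) (l : List (Fin 2)) (c b : ℝ) :
    Jw X (i :: l) c b = ∫ r in c..b, deriv (Zc X i) r * Jw X l r b := by simp [Jw, itIntC]

theorem deriv_Zc_shift (X : Fin 2 → ℝ → ℝ) (c : ℝ) (i : Fin 2) (r : ℝ) :
    deriv (Zc (fun i t => X i (t + c)) i) r = deriv (Zc X i) (r + c) := by
  rw [← deriv_comp_add_const]
  congr 1
  fin_cases i <;> rfl

theorem Jw_shift (X : Fin 2 → ℝ → ℝ) (l : List (Fin 2)) (c d b : ℝ) :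
    Jw (fun i t => X i (t + c)) l d (b - c) = Jw X l (d + c) b := by
  induction l generalizing d with
  | nil => simp [Jw_nil]
  | cons i l ih =>
    rw [Jw_cons, Jw_cons]
    simp_rw [ih, deriv_Zc_shift]
    rw [intervalIntegral.integral_comp_add_right (fun r => deriv (Zc X i) r * Jw X l r b)]
    simp

theorem Jw_congr {X Y : Fin 2 → ℝ → ℝ} {c b : ℝ} (l : List (Fin 2))
    (hXY : ∀ s, c ≤ s → ∀ i, Y i s = X i s) (r : ℝ) (hr : c ≤ r) (hb : r ≤ b) :
    Jw Y l r b = Jw X l r b := by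
  induction l generalizing r with
  | nil => simp [Jw_nil]
  | cons i l ih =>
    rw [Jw_cons, Jw_cons]
    apply intervalIntegral.integral_congr_ae
    refine Filter.Eventually.of_forall fun s hs => ?_
    rw [uIoc_of_le hb] at hs
    rw [ih s (hr.trans hs.1.le) hs.2]
    congr 1
    apply Filter.EventuallyEq.deriv_eq
    filter_upwards [Ioi_mem_nhds (lt_of_le_of_lt hr hs.1)] with t ht
    fin_cases i <;> simp [Zc, hXY t (le_of_lt ht)]

/-- Complexified velocity. -/
noncomputable def Zv (v : Fin 2 → ℝ) : Fin 2 → ℂ :=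
  ![(v 0 : ℂ) + Complex.I * (v 1 : ℂ), (v 0 : ℂ) - Complex.I * (v 1 : ℂ)]

theorem deriv_Zc_seg {X : Fin 2 → ℝ → ℝ} {c c' : ℝ} {v : Fin 2 → ℝ}
    (hX : ∀ s ∈ Icc c' c, ∀ i, X i s = X i c' + (s - c') * v i) (i : Fin 2)
    (s : ℝ) (hs : s ∈ Ioo c' c) : deriv (Zc X i) s = Zv v i := by
  have h1 : Zc X i =ᶠ[nhds s] fun t : ℝ => Zc X i c' + ((t : ℂ) - c') * Zv v i := by
    filter_upwards [Ioo_mem_nhds hs.1 hs.2] with t ht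
    have h2 := hX t ⟨ht.1.le, ht.2.le⟩
    fin_cases i <;> simp [Zc, Zv, h2] <;> ring
  rw [h1.deriv_eq]
  have h3 : HasDerivAt (fun t : ℝ => Zc X i c' + ((t : ℂ) - c') * Zv v i) (1 * Zv v i) s :=
    (((Complex.ofRealCLM.hasDerivAt (x := s)).sub_const (c' : ℂ)).mul_const (Zv v i)).const_add _
  rw [h3.deriv, one_mul]

theorem PLf.intervalIntegrable {X : Fin 2 → ℝ → ℝ} {b c : ℝ} (h : PLf X b c) (i : Fin 2) :
    IntervalIntegrable (deriv (Zc X i)) MeasureTheory.volume c b := by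
  induction h with
  | nil => exact IntervalIntegrable.refl
  | cons c c' v hc hX h ih =>
    refine IntervalIntegrable.trans ?_ ih
    have : IntervalIntegrable (fun _ : ℝ => Zv v i) MeasureTheory.volume c' c :=
      intervalIntegrable_const
    rw [intervalIntegrable_iff_integrableOn_Ioo_of_le hc] at this ⊢
    exact this.congr_fun (fun s hs => (deriv_Zc_seg hX i s hs).symm) measurableSet_Ioo

theorem PLf.continuousOn {X : Fin 2 → ℝ → ℝ} {b c : ℝ} (h : PLf X b c) (l : List (Fin 2)) :
    ContinuousOn (fun r => Jw X l r b) (uIcc c b) := by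
  induction l with
  | nil => simp only [Jw_nil]; exact continuousOn_const
  | cons i l ih =>
    simp only [Jw_cons]
    have h1 := (h.intervalIntegrable i).mul_continuousOn ih
    apply intervalIntegral.continuousOn_primitive_interval_left
    rwa [intervalIntegrable_iff', ] at h1

theorem key {n : ℕ} (a : (Fin (n + 1) → Fin 2) → ℂ)
    (h : ∀ X c b, PLf X b c → ∑ w, a w * Jw X (List.ofFn w) c b = 0)
    (X : Fin 2 → ℝ → ℝ) (c b : ℝ) (hP : PLf X b c) (v : Fin 2 → ℝ) :
    ∑ i, Zv v i * ∑ w : Fin n → Fin 2, a (Fin.cons i w) * Jw X (List.ofFn w) c b = 0 := by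
  set Y : Fin 2 → ℝ → ℝ := fun i s => if s < c then X i c + (s - c) * v i else X i s with hY
  have hYX : ∀ s, c ≤ s → ∀ i, Y i s = X i s := fun s hs i => by simp [hY, not_lt.2 hs]
  have hPY : PLf Y b c := hP.congr hYX
  have hYs : ∀ s, s ≤ c → ∀ i, Y i s = X i c + (s - c) * v i := fun s hs i => by
    rcases hs.lt_or_eq with h1 | h1
    · simp [hY, h1]
    · simp [hY, h1]
  have hseg : ∀ r, r ≤ c → ∀ s ∈ Icc r c, ∀ i, Y i s = Y i r + (s - r) * v i := by
    intro r hr s hs i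
    rw [hYs s hs.2, hYs r hr]; ring
  have hPr : ∀ r, r ≤ c → PLf Y b r := fun r hr => PLf.cons c r v hr (hseg r hr) hPY
  -- integrand
  set F : ℝ → ℂ := fun r => ∑ i, Zv v i * ∑ w : Fin n → Fin 2,
    a (Fin.cons i w) * Jw Y (List.ofFn w) r b with hF
  have hcb := hP.le
  have hFc : ContinuousOn F (Icc (c - 1) c) := by
    have : ∀ l, ContinuousOn (fun r => Jw Y l r b) (Icc (c - 1) c) := fun l =>
      ((hPr (c - 1) (by linarith)).continuousOn l).mono (by
        rw [uIcc_of_le (by linarith)]; exact Icc_subset_Icc_right hcb)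
    rw [hF]
    refine continuousOn_finsetSum _ fun i _ => continuousOn_const.mul ?_
    exact continuousOn_finsetSum _ fun w _ => continuousOn_const.mul (this _)
  have hsum : ∀ r, ∑ w, a w * Jw Y (List.ofFn w) r b =
      ∑ i, ∑ w : Fin n → Fin 2, a (Fin.cons i w) * Jw Y (i :: List.ofFn w) r b := by
    intro r
    rw [← (Fin.consEquiv fun _ => Fin 2).sum_comp, Fintype.sum_prod_type]
    simp [Fin.consEquiv]
  have hInt : ∀ r ∈ Icc (c - 1) c, ∫ s in r..c, F s = 0 := by
    intro r hr
    have hJc : ∀ l, ContinuousOn (fun r => Jw Y l r b) (uIcc r b) :=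
      fun l => (hPr r hr.2).continuousOn l
    have hJi : ∀ i l, IntervalIntegrable (fun s => deriv (Zc Y i) s * Jw Y l s b)
        MeasureTheory.volume r b := fun i l =>
      ((hPr r hr.2).intervalIntegrable i).mul_continuousOn (hJc l)
    have hsub : uIcc r c ⊆ uIcc r b := by
      rw [uIcc_of_le hr.2, uIcc_of_le (hr.2.trans hcb)]; exact Icc_subset_Icc_right hcb
    have hsub' : uIcc c b ⊆ uIcc r b := by
      rw [uIcc_of_le hcb, uIcc_of_le (hr.2.trans hcb)]; exact Icc_subset_Icc_left hr.2
    have hJs : ∀ l, IntervalIntegrable (fun s => Jw Y l s b) MeasureTheory.volume r c :=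
      fun l => ((hJc l).mono hsub).intervalIntegrable
    have hstep : ∀ i l, Jw Y (i :: l) r b - Jw Y (i :: l) c b
        = Zv v i * ∫ s in r..c, Jw Y l s b := by
      intro i l
      rw [Jw_cons, Jw_cons, ← intervalIntegral.integral_add_adjacent_intervals
        ((hJi i l).mono_set hsub) ((hJi i l).mono_set hsub'), add_sub_cancel_right,
        ← intervalIntegral.integral_const_mul]
      apply intervalIntegral.integral_congr_ae
      filter_upwards [MeasureTheory.Measure.ae_ne MeasureTheory.volume c] with s hsc hs
      rw [uIoc_of_le hr.2] at hs
      rw [deriv_Zc_seg (hseg r hr.2) i s ⟨hs.1, lt_of_le_of_ne hs.2 hsc⟩]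
    have e1 := h Y r b (hPr r hr.2)
    have e2 := h Y c b hPY
    rw [hsum] at e1 e2
    have e3 : ∫ s in r..c, F s = ∑ i, Zv v i * ∑ w : Fin n → Fin 2,
        a (Fin.cons i w) * ∫ s in r..c, Jw Y (List.ofFn w) s b := by
      rw [hF, intervalIntegral.integral_finsetSum]
      · refine Finset.sum_congr rfl fun i _ => ?_
        rw [intervalIntegral.integral_const_mul, intervalIntegral.integral_finsetSum]
        · simp_rw [intervalIntegral.integral_const_mul]
        · exact fun w _ => (hJs _).const_mul _
      · intro i _
        refine IntervalIntegrable.const_mul ?_ _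
        refine ContinuousOn.intervalIntegrable ?_
        exact continuousOn_finsetSum _ fun w _ => continuousOn_const.mul ((hJc _).mono hsub)
    rw [e3, ← sub_self (0 : ℂ)]
    nth_rewrite 1 [← e1]
    rw [← e2, ← Finset.sum_sub_distrib]
    refine Finset.sum_congr rfl fun i _ => ?_
    rw [← Finset.sum_sub_distrib, Finset.mul_sum]
    refine Finset.sum_congr rfl fun w _ => ?_
    rw [← mul_sub, hstep]; ring
  have hF0 : F c = 0 := by
    by_contra hne
    have hlt : c - 1 < c := by linarith
    have hFi : IntervalIntegrable F MeasureTheory.volume c (c - 1) := by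
      refine ContinuousOn.intervalIntegrable ?_
      rwa [uIcc_of_ge hlt.le]
    have hd : HasDerivWithinAt (fun u => ∫ s in c..u, F s) (F c) (Icc (c - 1) c) c := by
      have : Fact (c ∈ Icc (c - 1) c) := ⟨right_mem_Icc.2 hlt.le⟩
      exact intervalIntegral.integral_hasDerivWithinAt_right (by simp)
        (hFc.stronglyMeasurableAtFilter_nhdsWithin measurableSet_Icc c)
        (hFc c (right_mem_Icc.2 hlt.le))
    have hz : HasDerivWithinAt (fun u => ∫ s in c..u, F s) 0 (Icc (c - 1) c) c := by
      refine (hasDerivWithinAt_const c (Icc (c - 1) c) (0 : ℂ)).congr (fun u hu => ?_) (by simp)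
      rw [intervalIntegral.integral_symm, hInt u hu, neg_zero]
    exact hne (((uniqueDiffOn_Icc hlt) c (right_mem_Icc.2 hlt.le)).eq_deriv _ hd hz)
  rw [← hF0, hF]
  refine Finset.sum_congr rfl fun i _ => ?_
  congr 1
  refine Finset.sum_congr rfl fun w _ => ?_
  rw [Jw_congr _ hYX c le_rfl hcb]

theorem indep (n : ℕ) : ∀ (a : (Fin n → Fin 2) → ℂ),
    (∀ X c b, PLf X b c → ∑ w, a w * Jw X (List.ofFn w) c b = 0) → ∀ w, a w = 0 := by
  induction n with
  | zero =>
    intro a h w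
    have := h (fun _ _ => 0) 0 0 PLf.nil
    simp [Jw_nil] at this
    convert this
  | succ n ih =>
    intro a h w
    have hi : ∀ i, ∀ w' : Fin n → Fin 2, a (Fin.cons i w') = 0 := by
      intro i
      refine ih (fun w' => a (Fin.cons i w')) fun X c b hP => ?_
      have h1 := key a h X c b hP ![1, 0]
      have h2 := key a h X c b hP ![0, 1]
      simp only [Fin.sum_univ_two, Zv] at h1 h2
      simp at h1 h2
      set S0 := ∑ w : Fin n → Fin 2, a (Fin.cons 0 w) * Jw X (List.ofFn w) c b
      set S1 := ∑ w : Fin n → Fin 2, a (Fin.cons 1 w) * Jw X (List.ofFn w) c b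
      have h3 : S0 - S1 = 0 := by
        have : Complex.I * (S0 - S1) = 0 := by linear_combination h2
        simpa using this
      have hS0 : S0 = 0 := by linear_combination (h1 + h3) / 2
      have hS1 : S1 = 0 := by linear_combination (h1 - h3) / 2
      fin_cases i
      · exact hS0
      · exact hS1
    have := hi (w 0) (Fin.tail w)
    rwa [Fin.cons_self_tail] at this

/-- phase of each letter -/
noncomputable def ph (θ : ℝ) : Fin 2 → ℂ :=
  ![Complex.exp (-(θ * Complex.I)), Complex.exp (θ * Complex.I)]

theorem deriv_Zc_rot (θ : ℝ) (X : Fin 2 → ℝ → ℝ) (i : Fin 2) (r : ℝ) :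
    deriv (Zc (rot θ X) i) r = ph θ i * deriv (Zc X i) r := by
  rw [← deriv_const_mul_field]
  congr 1
  ext t
  have hI := Complex.I_mul_I
  fin_cases i
  · simp only [Zc, rot, ph, ← neg_mul, Complex.exp_mul_I, Complex.cos_neg, Complex.sin_neg]
    simp
    linear_combination (Complex.sin θ * X 1 t) * hI
  · simp only [Zc, rot, ph, Complex.exp_mul_I]
    simp
    linear_combination (- Complex.sin θ * X 1 t) * (-hI)

theorem Jw_rot (θ : ℝ) (X : Fin 2 → ℝ → ℝ) (l : List (Fin 2)) (c b : ℝ) :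
    Jw (rot θ X) l c b = (l.map (ph θ)).prod * Jw X l c b := by
  induction l generalizing c with
  | nil => simp [Jw_nil]
  | cons i l ih =>
    rw [Jw_cons, Jw_cons, List.map_cons, List.prod_cons, ← intervalIntegral.integral_const_mul]
    refine intervalIntegral.integral_congr fun s _ => ?_
    simp only [ih, deriv_Zc_rot]; ring

theorem ph_prod {n : ℕ} (θ : ℝ) (w : Fin n → Fin 2) :
    ((List.ofFn w).map (ph θ)).prod = Complex.exp (θ * Complex.I *
      (((Finset.univ.filter fun k => w k = 1).card : ℂ) -
        (Finset.univ.filter fun k => w k = 0).card)) := by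
  rw [List.map_ofFn, List.prod_ofFn]
  have : ∀ k, (ph θ ∘ w) k = Complex.exp (θ * Complex.I *
      ((if w k = 1 then 1 else 0) - (if w k = 0 then 1 else 0))) := by
    intro k
    have : w k = 0 ∨ w k = 1 := by omega
    rcases this with h | h <;> simp [ph, h]
  simp_rw [this]
  rw [← Complex.exp_sum, ← Finset.mul_sum, Finset.sum_sub_distrib]
  simp

/-- if the degree-n homogeneous φ = Σ_w a_w c_w is rotation invariant
(pairing with the signature unchanged under rotation for all piecewise linear curves),
then a_w = 0 for every word w with unequal numbers of letters 1 and 2. -/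
theorem stmt16 (n : ℕ) (a : (Fin n → Fin 2) → ℂ)
    (h : ∀ (X : Fin 2 → ℝ → ℝ) (T θ : ℝ), IsPWLinear X T →
      ∑ w : Fin n → Fin 2, a w * sigC (rot θ X) T w =
        ∑ w : Fin n → Fin 2, a w * sigC X T w) :
    ∀ w : Fin n → Fin 2,
      (Finset.univ.filter fun k => w k = 0).card ≠
        (Finset.univ.filter fun k => w k = 1).card → a w = 0 := by
  intro w hw
  set k : ℝ := ((Finset.univ.filter fun k => w k = 1).card : ℝ) -
        (Finset.univ.filter fun k => w k = 0).card with hk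
  have hk0 : k ≠ 0 := by
    rw [hk, sub_ne_zero]
    exact fun e => hw (by exact_mod_cast e.symm)
  have hm := indep n (fun w => a w * (((List.ofFn w).map (ph (Real.pi / k))).prod - 1)) (by
    intro X c b hP
    have e := h _ _ (Real.pi / k) hP.isPW
    have e1 : ∀ w : Fin n → Fin 2, sigC (fun i t => X i (t + c)) (b - c) w
        = Jw X (List.ofFn w) c b := by
      intro w
      have := Jw_shift X (List.ofFn w) c 0 b
      rwa [zero_add] at this
    have e2 : ∀ w : Fin n → Fin 2,
        sigC (rot (Real.pi / k) (fun i t => X i (t + c))) (b - c) w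
        = ((List.ofFn w).map (ph (Real.pi / k))).prod * Jw X (List.ofFn w) c b := by
      intro w
      rw [← e1]
      exact Jw_rot _ _ _ _ _
    simp_rw [e1, e2] at e
    rw [← sub_eq_zero, ← Finset.sum_sub_distrib] at e
    rw [← e]
    exact Finset.sum_congr rfl fun w _ => by ring) w
  simp only [ph_prod] at hm
  have hkC : (k : ℂ) ≠ 0 := by exact_mod_cast hk0
  have e3 : ((Real.pi / k : ℝ) : ℂ) * Complex.I *
      (((Finset.univ.filter fun k => w k = 1).card : ℂ) -
        (Finset.univ.filter fun k => w k = 0).card) = Real.pi * Complex.I := by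
    have : (((Finset.univ.filter fun k => w k = 1).card : ℂ) -
        (Finset.univ.filter fun k => w k = 0).card) = (k : ℂ) := by
      rw [hk]; push_cast; rfl
    rw [this]; push_cast; field_simp
  rw [e3, Complex.exp_pi_mul_I] at hm
  rcases mul_eq_zero.1 hm with h1 | h1
  · exact h1
  · norm_num at h1
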